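/- Let A be a unital C*-algebra, let I be a nonempty finite index set, let 0 < ε ≤ 1/4, and let (v'_{μν})_{μ,ν∈I} be a family of unitaries in A satisfying v'_{μμ} = 1, (v'_{μν})* = v'_{νμ}, and ‖v'_{μσ}·v'_{σν} − v'_{μν}‖ < ε for all μ, ν, σ ∈ I. Let (η_σ)_{σ∈I} be nonnegative real numbers with Σ_σ η_σ² = 1, and set a_{μν} := Σ_σ η_σ²·v'_{μσ}·v'_{σν} ∈ A. Then each a_{μμ} is a positive invertible element of A, and for all μ, ν ∈ I one has ‖ a_{μμ}^{−1/2} · a_{μν} · a_{νν}^{−1/2} − v'_{μν} ‖ < 4ε, where a_{μμ}^{−1/2} denotes the inverse of the positive square root of a_{μμ} given by continuous functional calculus. -/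

import Mathlib

/-- The inverse positive square root `a^(-1/2)` of an element of a C*-algebra, defined via
the continuous functional calculus applied to `t ↦ t^(-1/2) = (√t)⁻¹`. -/
noncomputable def invSqrt {A : Type*} [CStarAlgebra A] (a : A) : A :=
  cfc (fun t : ℝ => (Real.sqrt t)⁻¹) a

/-- Lemma `lem:polar`: for a family of unitaries `v'` satisfying an
ε-approximate cocycle condition (with `0 < ε ≤ 1/4`), and a square-root partition of unity
`η`, the elements `a μ μ = Σ_σ η_σ² v'_{μσ} v'_{σμ}` are positive invertible and the
polar-type corrections `a_{μμ}^(−1/2) a_{μν} a_{νν}^(−1/2)` stay `4ε`-close to `v'_{μν}`. -/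
theorem polar_correction
    {I A : Type*} [Fintype I] [Nonempty I] [CStarAlgebra A]
    [PartialOrder A] [StarOrderedRing A]
    (ε : ℝ) (hε0 : 0 < ε) (hε : ε ≤ 1 / 4)
    (v' : I → I → A) (hunit : ∀ μ ν, v' μ ν ∈ unitary A)
    (hdiag : ∀ μ, v' μ μ = 1) (hstar : ∀ μ ν, star (v' μ ν) = v' ν μ)
    (hcoc : ∀ μ ν σ, ‖v' μ σ * v' σ ν - v' μ ν‖ < ε)
    (η : I → ℝ) (hη : ∀ σ, 0 ≤ η σ) (hsum : ∑ σ, η σ ^ 2 = 1)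
    (a : I → I → A) (ha : ∀ μ ν, a μ ν = ∑ σ, η σ ^ 2 • (v' μ σ * v' σ ν)) :
    (∀ μ, 0 ≤ a μ μ ∧ IsUnit (a μ μ)) ∧
      ∀ μ ν, ‖invSqrt (a μ μ) * a μ ν * invSqrt (a ν ν) - v' μ ν‖ < 4 * ε := by
  have h1 : ∀ μ, a μ μ = 1 := by
    intro μ
    have h : ∀ σ, v' μ σ * v' σ μ = 1 := by
      intro σ
      rw [← hstar μ σ]
      exact (Unitary.mem_iff.mp (hunit μ σ)).2
    rw [ha]
    simp only [h]
    rw [← Finset.sum_smul, hsum, one_smul]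
  have h2 : invSqrt (1 : A) = 1 := by
    have h := cfc_algebraMap (A := A) (1 : ℝ) (fun t : ℝ => (Real.sqrt t)⁻¹)
    simpa [invSqrt] using h
  refine ⟨fun μ => ?_, fun μ ν => ?_⟩
  · rw [h1]
    exact ⟨zero_le_one, isUnit_one⟩
  · rw [h1, h1, h2, one_mul, mul_one]
    have h3 : a μ ν - v' μ ν = ∑ σ, η σ ^ 2 • (v' μ σ * v' σ ν - v' μ ν) := by
      simp only [smul_sub, Finset.sum_sub_distrib]
      rw [← Finset.sum_smul, hsum, one_smul, ha]
    have h4 : ‖a μ ν - v' μ ν‖ ≤ ε := by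
      rw [h3]
      calc _ ≤ ∑ σ, η σ ^ 2 * ε := by
            refine norm_sum_le_of_le _ fun σ _ => ?_
            rw [norm_smul, Real.norm_of_nonneg (sq_nonneg _)]
            exact mul_le_mul_of_nonneg_left (hcoc μ ν σ).le (sq_nonneg _)
        _ = ε := by rw [← Finset.sum_mul, hsum, one_mul]
    linarith
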